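/- arXiv:1509.09188 — 2 statements merged into one kernel-verified Lean document; each statement's English description precedes it below -/
import Mathlib

section
/- If Ψ ≥ 400·k^3/ε^2 for some ε ∈ (0,1), then for every i ∈ {1,…,k} the rows of the matrix B satisfy 1 − ε ≤ ⟨B_{i,:}, B_{i,:}⟩ ≤ 1 + ε. -/
open Finset BigOperators Matrix

namespace SpectralClustering

variable {V : Type} [Fintype V] [DecidableEq V]

/-- Volume of a vertex set: the sum of the degrees of its vertices. -/
def vol (G : SimpleGraph V) [DecidableRel G.Adj] (S : Finset V) : ℕ :=
  ∑ v ∈ S, G.degree v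

/-- Number of edges between two (disjoint) vertex sets. -/
def cut (G : SimpleGraph V) [DecidableRel G.Adj] (S T : Finset V) : ℕ :=
  ∑ u ∈ S, (T.filter fun v => G.Adj u v).card

/-- Conductance `φ(S) = |E(S, V \ S)| / μ(S)`. -/
noncomputable def conductance (G : SimpleGraph V) [DecidableRel G.Adj] (S : Finset V) : ℝ :=
  (cut G S Sᶜ : ℝ) / (vol G S : ℝ)

/-- A `k`-way partition of the vertex set into nonempty blocks. -/
def IsKWayPartition {k : ℕ} (P : Fin k → Finset V) : Prop :=
  (∀ i, (P i).Nonempty) ∧ (∀ i j, i ≠ j → Disjoint (P i) (P j)) ∧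
    (∀ v : V, ∃ i, v ∈ P i)

/-- Maximum conductance over the blocks of a tuple of sets. -/
noncomputable def maxCond (G : SimpleGraph V) [DecidableRel G.Adj] {k : ℕ}
    (P : Fin k → Finset V) : ℝ :=
  ⨆ i, conductance G (P i)

/-- Average conductance of the blocks. -/
noncomputable def avgCond (G : SimpleGraph V) [DecidableRel G.Adj] {k : ℕ}
    (P : Fin k → Finset V) : ℝ :=
  (∑ i, conductance G (P i)) / (k : ℝ)

/-- `P` achieves `ρ̂_avr(k)`: it minimizes the maximum conductance among all
`k`-way partitions, and among those it has minimal average conductance. -/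
def AchievesRhoAvr (G : SimpleGraph V) [DecidableRel G.Adj] {k : ℕ}
    (P : Fin k → Finset V) : Prop :=
  IsKWayPartition P ∧
  (∀ Q : Fin k → Finset V, IsKWayPartition Q → maxCond G P ≤ maxCond G Q) ∧
  (∀ Q : Fin k → Finset V, IsKWayPartition Q → maxCond G Q = maxCond G P →
    avgCond G P ≤ avgCond G Q)

/-- Dot product of two vectors indexed by the vertices. -/
def dotV (x y : V → ℝ) : ℝ := ∑ v, x v * y v

/-- The normalized Laplacian `I - D^{-1/2} A D^{-1/2}`. -/
noncomputable def normLap (G : SimpleGraph V) [DecidableRel G.Adj] : Matrix V V ℝ :=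
  1 - Matrix.diagonal (fun v => (Real.sqrt (G.degree v))⁻¹) * G.adjMatrix ℝ *
      Matrix.diagonal (fun v => (Real.sqrt (G.degree v))⁻¹)

/-- `f` is an orthonormal family of eigenvectors of the normalized Laplacian of `G`
with (sorted) eigenvalues `lam`. -/
structure EigenData (G : SimpleGraph V) [DecidableRel G.Adj]
    (f : Fin (Fintype.card V) → V → ℝ) (lam : Fin (Fintype.card V) → ℝ) : Prop where
  eig : ∀ i, (normLap G).mulVec (f i) = lam i • f i
  ortho : ∀ i j, dotV (f i) (f j) = if i = j then (1 : ℝ) else 0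
  mono : Monotone lam

/-- The gap parameter `Ψ = λ_{k+1} / ρ̂_avr(k)`, where `ρ̂_avr(k)` is realized as the
average conductance of the fixed optimal partition `P`. -/
noncomputable def Psi (G : SimpleGraph V) [DecidableRel G.Adj]
    (lam : Fin (Fintype.card V) → ℝ) {k : ℕ} (P : Fin k → Finset V)
    (hkn : k < Fintype.card V) : ℝ :=
  lam ⟨k, hkn⟩ / avgCond G P

/-- The spectral embedding `F(u) = d_u^{-1/2} (f_1(u), …, f_k(u))`. -/
noncomputable def Femb (G : SimpleGraph V) [DecidableRel G.Adj]
    (f : Fin (Fintype.card V) → V → ℝ) {k : ℕ} (hk : k ≤ Fintype.card V) (u : V) :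
    Fin k → ℝ :=
  fun j => f (Fin.castLE hk j) u / Real.sqrt (G.degree u)

/-- `k`-means cost of a clustering of the (degree-weighted) spectral embedding:
`∑_i ∑_{u ∈ A_i} d_u ‖F(u) - c_i‖²`. -/
noncomputable def kmCost (G : SimpleGraph V) [DecidableRel G.Adj]
    (f : Fin (Fintype.card V) → V → ℝ) {k : ℕ} (hk : k ≤ Fintype.card V) {ℓ : ℕ}
    (A : Fin ℓ → Finset V) (c : Fin ℓ → Fin k → ℝ) : ℝ :=
  ∑ i, ∑ u ∈ A i, (G.degree u : ℝ) * ∑ j, (Femb G f hk u j - c i j) ^ 2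

/-- `Δ_ℓ(𝒳_V)`: the optimal `ℓ`-means cost of the spectral embedding multiset `𝒳_V`
(which contains `d_u` copies of `F(u)` for every vertex `u`). -/
noncomputable def kmOpt (G : SimpleGraph V) [DecidableRel G.Adj]
    (f : Fin (Fintype.card V) → V → ℝ) {k : ℕ} (hk : k ≤ Fintype.card V) (ℓ : ℕ) : ℝ :=
  sInf { r : ℝ | ∃ (A : Fin ℓ → Finset V) (c : Fin ℓ → Fin k → ℝ),
    (∀ i j, i ≠ j → Disjoint (A i) (A j)) ∧ (∀ v : V, ∃ i, v ∈ A i) ∧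
    r = kmCost G f hk A c }

/-- Normalized characteristic vector `ḡ_i = D^{1/2} χ_{P_i} / √μ(P_i)`. -/
noncomputable def gbar (G : SimpleGraph V) [DecidableRel G.Adj] {k : ℕ}
    (P : Fin k → Finset V) (i : Fin k) : V → ℝ :=
  fun v => (if v ∈ P i then Real.sqrt (G.degree v) else 0) / Real.sqrt (vol G (P i))

/-- Coefficients `α_j^{(i)} = ⟨ḡ_i, f_j⟩` of `ḡ_i` in the eigenbasis. -/
noncomputable def alpha (G : SimpleGraph V) [DecidableRel G.Adj] {k : ℕ}
    (P : Fin k → Finset V) (f : Fin (Fintype.card V) → V → ℝ)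
    (i : Fin k) (j : Fin (Fintype.card V)) : ℝ :=
  dotV (gbar G P i) (f j)

/-- Projection `f̂_i = ∑_{j=1}^k α_j^{(i)} f_j` of `ḡ_i` onto the first `k` eigenvectors. -/
noncomputable def fhat (G : SimpleGraph V) [DecidableRel G.Adj] {k : ℕ}
    (P : Fin k → Finset V) (f : Fin (Fintype.card V) → V → ℝ) (i : Fin k) : V → ℝ :=
  fun v => ∑ j : Fin (Fintype.card V),
    if (j : ℕ) < k then alpha G P f i j * f j v else 0

/-- Estimation center `p^{(i)} = μ(P_i)^{-1/2} (β_i^{(1)}, …, β_i^{(k)})`;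
here `beta i j` denotes `β_j^{(i)}`. -/
noncomputable def estCenter (G : SimpleGraph V) [DecidableRel G.Adj] {k : ℕ}
    (P : Fin k → Finset V) (beta : Fin k → Fin k → ℝ) (i : Fin k) : Fin k → ℝ :=
  fun j => beta j i / Real.sqrt (vol G (P i))

/-- The quadratic form of the normalized Laplacian. -/
theorem dotV_normLap_mulVec (G : SimpleGraph V) [DecidableRel G.Adj]
    (hd : ∀ v : V, 0 < G.degree v) (x : V → ℝ) :
    dotV x ((normLap G).mulVec x) =
      (∑ u, ∑ v, if G.Adj u v then
        (x u / Real.sqrt (G.degree u) - x v / Real.sqrt (G.degree v)) ^ 2 else 0) / 2 := by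
  rw [← G.lapMatrix_toLinearMap₂' ℝ (fun u => x u / Real.sqrt (G.degree u)),
    Matrix.toLinearMap₂'_apply']
  have hs : ∀ v, Real.sqrt (G.degree v) * Real.sqrt (G.degree v) = G.degree v :=
    fun v => Real.mul_self_sqrt (Nat.cast_nonneg _)
  have hne : ∀ v, Real.sqrt (G.degree v) ≠ 0 :=
    fun v => (Real.sqrt_pos.2 (Nat.cast_pos.2 (hd v))).ne'
  unfold dotV dotProduct
  refine Finset.sum_congr rfl fun v _ => ?_
  have hL : (normLap G).mulVec x v = x v - (Real.sqrt (G.degree v))⁻¹ *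
      ∑ u ∈ G.neighborFinset v, x u / Real.sqrt (G.degree u) := by
    have hx : (Matrix.diagonal fun v => (Real.sqrt (G.degree v))⁻¹).mulVec x =
        fun u => x u / Real.sqrt (G.degree u) := by
      ext u
      rw [Matrix.mulVec_diagonal, div_eq_inv_mul]
    rw [normLap, Matrix.sub_mulVec, Matrix.one_mulVec, ← Matrix.mulVec_mulVec, hx,
      ← Matrix.mulVec_mulVec, Pi.sub_apply, Matrix.mulVec_diagonal,
      SimpleGraph.adjMatrix_mulVec_apply]
  rw [hL, SimpleGraph.lapMatrix_mulVec_apply]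
  have := hne v
  field_simp
  linear_combination x v ^ 2 * hs v

theorem normLap_transpose (G : SimpleGraph V) [DecidableRel G.Adj] :
    (normLap G)ᵀ = normLap G := by
  simp [normLap, Matrix.transpose_mul, Matrix.mul_assoc]

theorem dotV_normLap_comm (G : SimpleGraph V) [DecidableRel G.Adj] (x y : V → ℝ) :
    dotV x ((normLap G).mulVec y) = dotV ((normLap G).mulVec x) y := by
  change x ⬝ᵥ _ = _ ⬝ᵥ y
  rw [Matrix.dotProduct_mulVec, ← Matrix.mulVec_transpose, normLap_transpose]

/-- Parseval's identity for an orthonormal family of full cardinality. -/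
theorem dotV_eq_sum_of_orthonormal {f : Fin (Fintype.card V) → V → ℝ}
    (hf : ∀ i j, dotV (f i) (f j) = if i = j then (1 : ℝ) else 0) (x y : V → ℝ) :
    dotV x y = ∑ j, dotV x (f j) * dotV y (f j) := by
  have h1 : (Matrix.of f) * (Matrix.of f)ᵀ = 1 := by
    ext i j
    rw [Matrix.one_apply, ← hf i j]
    rfl
  have h2 : (Matrix.of f)ᵀ * (Matrix.of f) = 1 :=
    (Matrix.mul_eq_one_comm_of_card_eq _ _ _ (by simp)).1 h1
  have h3 : ∀ z : V → ℝ, (fun j => dotV z (f j)) = (Matrix.of f).mulVec z := by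
    intro z
    ext j
    simp [dotV, Matrix.mulVec, dotProduct, mul_comm]
  change x ⬝ᵥ y = (fun j => dotV x (f j)) ⬝ᵥ (fun j => dotV y (f j))
  rw [h3, h3, Matrix.dotProduct_mulVec, Matrix.vecMul_mulVec, h2, Matrix.vecMul_one]

theorem EigenData.dotV_normLap_eq_sum {G : SimpleGraph V} [DecidableRel G.Adj]
    {f : Fin (Fintype.card V) → V → ℝ} {lam : Fin (Fintype.card V) → ℝ}
    (hf : EigenData G f lam) (x : V → ℝ) :
    dotV x ((normLap G).mulVec x) = ∑ j, lam j * dotV x (f j) ^ 2 := by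
  rw [dotV_eq_sum_of_orthonormal hf.ortho]
  refine Finset.sum_congr rfl fun j _ => ?_
  have h : dotV x (lam j • f j) = lam j * dotV x (f j) := dotProduct_smul (lam j) x (f j)
  rw [← dotV_normLap_comm, hf.eig, h]
  ring

theorem EigenData.lam_nonneg {G : SimpleGraph V} [DecidableRel G.Adj]
    (hd : ∀ v : V, 0 < G.degree v)
    {f : Fin (Fintype.card V) → V → ℝ} {lam : Fin (Fintype.card V) → ℝ}
    (hf : EigenData G f lam) (j : Fin (Fintype.card V)) : 0 ≤ lam j := by
  have h : dotV (f j) ((normLap G).mulVec (f j)) = lam j := by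
    have h' : dotV (f j) (lam j • f j) = lam j * dotV (f j) (f j) :=
      dotProduct_smul (lam j) (f j) (f j)
    rw [hf.eig, h', hf.ortho, if_pos rfl, mul_one]
  rw [← h, dotV_normLap_mulVec G hd]
  positivity

theorem vol_pos {V : Type} [Fintype V] {G : SimpleGraph V} [DecidableRel G.Adj] (hd : ∀ v : V, 0 < G.degree v)
    {S : Finset V} (hS : S.Nonempty) : 0 < vol G S :=
  Finset.sum_pos (fun v _ => hd v) hS

/-- The Rayleigh quotient of a normalized indicator vector is the conductance. -/
theorem dotV_normLap_gbar (G : SimpleGraph V) [DecidableRel G.Adj]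
    (hd : ∀ v : V, 0 < G.degree v) {k : ℕ} (P : Fin k → Finset V) (i : Fin k) :
    dotV (gbar G P i) ((normLap G).mulVec (gbar G P i)) = conductance G (P i) := by
  have hne : ∀ v, Real.sqrt (G.degree v) ≠ 0 :=
    fun v => (Real.sqrt_pos.2 (Nat.cast_pos.2 (hd v))).ne'
  have hg : ∀ v, gbar G P i v / Real.sqrt (G.degree v) =
      (if v ∈ P i then 1 else 0) / Real.sqrt (vol G (P i)) := by
    intro v
    have := hne v
    unfold gbar
    split_ifs
    · field_simp
    · simp
  have hterm : ∀ u v, (if G.Adj u v then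
        (gbar G P i u / Real.sqrt (G.degree u) - gbar G P i v / Real.sqrt (G.degree v)) ^ 2
        else 0) =
      ((if u ∈ P i then if v ∈ (P i)ᶜ then if G.Adj u v then (1 : ℝ) else 0 else 0 else 0) +
        (if v ∈ P i then if u ∈ (P i)ᶜ then if G.Adj v u then (1 : ℝ) else 0 else 0 else 0))
        / (vol G (P i) : ℝ) := by
    intro u v
    rw [hg, hg, ← sub_div, div_pow, Real.sq_sqrt (Nat.cast_nonneg _)]
    simp only [G.adj_comm v u]
    by_cases h1 : u ∈ P i <;> by_cases h2 : v ∈ P i <;> by_cases h3 : G.Adj u v <;>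
      simp [h1, h2, h3]
  have hcut : (∑ u, ∑ v,
      (if u ∈ P i then if v ∈ (P i)ᶜ then if G.Adj u v then (1 : ℝ) else 0 else 0 else 0)) =
      cut G (P i) (P i)ᶜ := by
    unfold cut
    push_cast
    rw [← Finset.sum_filter_add_sum_filter_not Finset.univ (· ∈ P i)]
    rw [Finset.sum_eq_zero (s := Finset.univ.filter fun u => ¬ u ∈ P i), add_zero,
      Finset.filter_mem_eq_inter, Finset.univ_inter]
    · refine Finset.sum_congr rfl fun u hu => ?_
      simp only [hu, if_true]
      rw [Finset.card_filter, Finset.sum_ite_mem, Finset.univ_inter]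
      push_cast
      rfl
    · intro u hu
      simp [(Finset.mem_filter.1 hu).2]
  rw [dotV_normLap_mulVec G hd]
  simp_rw [hterm, ← Finset.sum_div, Finset.sum_add_distrib]
  rw [hcut, Finset.sum_comm, hcut, conductance]
  ring

theorem dotV_gbar_gbar (G : SimpleGraph V) [DecidableRel G.Adj]
    (hd : ∀ v : V, 0 < G.degree v) {k : ℕ} {P : Fin k → Finset V} (hP : IsKWayPartition P)
    (i j : Fin k) : dotV (gbar G P i) (gbar G P j) = if i = j then (1 : ℝ) else 0 := by
  unfold dotV gbar
  split_ifs with h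
  · subst h
    have hv : (0 : ℝ) < vol G (P i) := Nat.cast_pos.2 (vol_pos hd (hP.1 i))
    have hterm : ∀ v, (if v ∈ P i then Real.sqrt (G.degree v) else 0) / Real.sqrt (vol G (P i)) *
        ((if v ∈ P i then Real.sqrt (G.degree v) else 0) / Real.sqrt (vol G (P i))) =
        (if v ∈ P i then (G.degree v : ℝ) else 0) / vol G (P i) := by
      intro v
      rw [div_mul_div_comm, Real.mul_self_sqrt hv.le]
      split_ifs
      · rw [Real.mul_self_sqrt (Nat.cast_nonneg _)]
      · simp
    simp_rw [hterm, ← Finset.sum_div]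
    rw [Finset.sum_ite_mem, Finset.univ_inter, div_eq_one_iff_eq hv.ne', vol]
    push_cast
    rfl
  · refine Finset.sum_eq_zero fun v _ => ?_
    by_cases hi : v ∈ P i
    · have hj : v ∉ P j := Finset.disjoint_left.1 (hP.2.1 i j h) hi
      simp [hj]
    · simp [hi]

theorem sum_ite_val_lt {n k : ℕ} (h : k ≤ n) (c : Fin n → ℝ) :
    (∑ j : Fin n, if (j : ℕ) < k then c j else 0) = ∑ j : Fin k, c (Fin.castLE h j) := by
  obtain ⟨m, rfl⟩ := Nat.exists_eq_add_of_le h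
  rw [Fin.sum_univ_add]
  simp
  rfl

theorem dotV_sum_mul_left {V : Type} [Fintype V] {ι : Type*} [Fintype ι] (c : ι → ℝ) (g : ι → V → ℝ) (y : V → ℝ) :
    dotV (fun v => ∑ i, c i * g i v) y = ∑ i, c i * dotV (g i) y := by
  unfold dotV
  simp_rw [Finset.sum_mul, Finset.mul_sum]
  rw [Finset.sum_comm]
  simp_rw [mul_assoc]

theorem EigenData.dotV_fhat {G : SimpleGraph V} [DecidableRel G.Adj]
    {f : Fin (Fintype.card V) → V → ℝ} {lam : Fin (Fintype.card V) → ℝ}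
    (hf : EigenData G f lam) {k : ℕ} (hk : k ≤ Fintype.card V) (P : Fin k → Finset V)
    (i l : Fin k) :
    dotV (fhat G P f i) (f (Fin.castLE hk l)) = alpha G P f i (Fin.castLE hk l) := by
  have h : fhat G P f i = fun v =>
      ∑ j : Fin (Fintype.card V), (if (j : ℕ) < k then alpha G P f i j else 0) * f j v := by
    ext v
    simp [fhat, ite_mul]
  rw [h, dotV_sum_mul_left]
  simp [hf.ortho]

/-- Spectral mass of `ḡ_i` outside the first `k` eigenvectors. -/
theorem EigenData.lam_mul_tail_le {G : SimpleGraph V} [DecidableRel G.Adj]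
    (hd : ∀ v : V, 0 < G.degree v)
    {f : Fin (Fintype.card V) → V → ℝ} {lam : Fin (Fintype.card V) → ℝ}
    (hf : EigenData G f lam) {k : ℕ} (hkn : k < Fintype.card V) (P : Fin k → Finset V)
    (i : Fin k) :
    lam ⟨k, hkn⟩ * (∑ l : Fin (Fintype.card V), if (l : ℕ) < k then 0 else alpha G P f i l ^ 2) ≤
      conductance G (P i) := by
  rw [← dotV_normLap_gbar G hd, hf.dotV_normLap_eq_sum, Finset.mul_sum]
  refine Finset.sum_le_sum fun l _ => ?_
  split_ifs with h
  · rw [mul_zero]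
    exact mul_nonneg (hf.lam_nonneg hd l) (sq_nonneg _)
  · exact mul_le_mul_of_nonneg_right (hf.mono (Fin.mk_le_of_le_val (not_lt.1 h))) (sq_nonneg _)

/-- The squared norm of `∑ x_i ḡ_i` in terms of its spectral coefficients. -/
theorem EigenData.sum_sq_alpha {G : SimpleGraph V} [DecidableRel G.Adj]
    (hd : ∀ v : V, 0 < G.degree v)
    {f : Fin (Fintype.card V) → V → ℝ} {lam : Fin (Fintype.card V) → ℝ}
    (hf : EigenData G f lam) {k : ℕ} {P : Fin k → Finset V} (hP : IsKWayPartition P)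
    (x : Fin k → ℝ) :
    ∑ l, (∑ i, x i * alpha G P f i l) ^ 2 = ∑ i, x i ^ 2 := by
  have h := dotV_eq_sum_of_orthonormal hf.ortho
    (fun v => ∑ i, x i * gbar G P i v) (fun v => ∑ i, x i * gbar G P i v)
  have hc : ∀ i, dotV (gbar G P i) (fun v => ∑ j, x j * gbar G P j v) = x i := by
    intro i
    have hsymm : ∀ a b : V → ℝ, dotV a b = dotV b a := fun a b => dotProduct_comm a b
    rw [hsymm, dotV_sum_mul_left]
    simp [dotV_gbar_gbar G hd hP]
  rw [dotV_sum_mul_left] at h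
  simp_rw [hc, dotV_sum_mul_left] at h
  simp_rw [sq]
  exact h.symm

/-- A near-isometry on the left forces the columns of the left inverse to be almost unit. -/
theorem sum_sq_column_bounds {k : ℕ} {B M : Matrix (Fin k) (Fin k) ℝ} (hBM : B * M = 1) {t : ℝ}
    (ht : t < 1)
    (hlow : ∀ x : Fin k → ℝ, (1 - t) * ∑ i, x i ^ 2 ≤ ∑ l, (x ᵥ* M) l ^ 2)
    (hup : ∀ x : Fin k → ℝ, ∑ l, (x ᵥ* M) l ^ 2 ≤ ∑ i, x i ^ 2) (i : Fin k) :
    1 ≤ ∑ l, B l i ^ 2 ∧ (1 - t) * ∑ l, B l i ^ 2 ≤ 1 := by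
  have hMB : M * B = 1 := mul_eq_one_comm.1 hBM
  set s := ∑ l, B l i ^ 2 with hs
  have hs0 : 0 ≤ s := Finset.sum_nonneg fun _ _ => sq_nonneg _
  have hone : 1 ≤ s := by
    have h1 : ∑ l, M i l * B l i = 1 := by
      have := congrFun (congrFun hMB i) i
      simpa [Matrix.mul_apply] using this
    have h2 : ∑ l, M i l ^ 2 ≤ 1 := by
      have := hup (Pi.single i 1)
      simpa [Pi.single_apply, ite_pow] using this
    have h3 := Finset.sum_mul_sq_le_sq_mul_sq Finset.univ (fun l => M i l) (fun l => B l i)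
    rw [h1] at h3
    nlinarith
  refine ⟨hone, ?_⟩
  set b : Fin k → ℝ := fun l => B l i with hb
  have hx : (b ᵥ* B) ᵥ* M = b := by
    rw [Matrix.vecMul_vecMul, hBM, Matrix.vecMul_one]
  have h1 : (b ᵥ* B) i = s := by
    simp [Matrix.vecMul, dotProduct, hb, hs, sq]
  have h2 := hlow (b ᵥ* B)
  rw [hx] at h2
  have h3 : s ^ 2 ≤ ∑ j, (b ᵥ* B) j ^ 2 := by
    rw [← h1]
    exact Finset.single_le_sum (f := fun j => (b ᵥ* B) j ^ 2) (fun _ _ => sq_nonneg _)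
      (Finset.mem_univ i)
  have h4 : (1 - t) * s ^ 2 ≤ s :=
    (mul_le_mul_of_nonneg_left h3 (sub_nonneg.2 ht.le)).trans h2
  have hpos : 0 < s := by linarith
  refine le_of_mul_le_mul_right ?_ hpos
  linarith [h4, sq s, mul_assoc (1 - t) s s, one_mul s]

theorem rows_of_B_norm_bounds
    {V : Type} [Fintype V] [DecidableEq V] (G : SimpleGraph V) [DecidableRel G.Adj]
    (hd : ∀ v : V, 0 < G.degree v)
    {k : ℕ} (hkn : k < Fintype.card V)
    (f : Fin (Fintype.card V) → V → ℝ) (lam : Fin (Fintype.card V) → ℝ)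
    (hf : EigenData G f lam)
    (P : Fin k → Finset V) (hP : AchievesRhoAvr G P)
    (beta : Fin k → Fin k → ℝ)
    (hbeta : ∀ i : Fin k,
      f (Fin.castLE hkn.le i) = fun v => ∑ j : Fin k, beta i j * fhat G P f j v)
    (ε : ℝ) (hε0 : 0 < ε) (hε1 : ε < 1)
    (hPsi : Psi G lam P hkn ≥ 400 * (k : ℝ) ^ 3 / ε ^ 2) :
    ∀ i : Fin k,
      1 - ε ≤ ∑ l : Fin k, beta l i * beta l i ∧
        ∑ l : Fin k, beta l i * beta l i ≤ 1 + ε := by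
  intro i
  have hk : 0 < k := i.pos
  have hkR : (1 : ℝ) ≤ k := by exact_mod_cast hk
  have hPart := hP.1
  set Λ := lam ⟨k, hkn⟩ with hΛ
  set t : ℝ := ∑ j, ∑ l : Fin (Fintype.card V), if (l : ℕ) < k then 0 else alpha G P f j l ^ 2
    with htdef
  have ht0 : 0 ≤ t := by positivity
  have htΛ : Λ * t ≤ k * avgCond G P := by
    rw [htdef, Finset.mul_sum, avgCond, mul_div_cancel₀ _ (by positivity)]
    exact Finset.sum_le_sum fun j _ => hf.lam_mul_tail_le hd hkn P j
  have havg0 : 0 ≤ avgCond G P := by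
    unfold avgCond conductance
    positivity
  have hPsi' : 400 * (k : ℝ) ^ 3 / ε ^ 2 ≤ Λ / avgCond G P := hPsi
  have havg : 0 < avgCond G P := by
    refine havg0.lt_of_ne fun h => ?_
    rw [← h, div_zero] at hPsi'
    have : 0 < 400 * (k : ℝ) ^ 3 / ε ^ 2 := by positivity
    linarith
  have hΛavg : 400 * (k : ℝ) ^ 3 * avgCond G P ≤ Λ * ε ^ 2 := by
    rwa [div_le_div_iff₀ (by positivity) havg] at hPsi'
  have ht : 400 * t ≤ ε ^ 2 := by
    have hΛpos : 0 < Λ := by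
      by_contra hneg
      have : 0 < 400 * (k : ℝ) ^ 3 * avgCond G P := by positivity
      nlinarith [sq_nonneg ε]
    have hkk : (k : ℝ) ≤ (k : ℝ) ^ 3 := le_self_pow₀ hkR (by norm_num)
    have : Λ * (400 * t) ≤ Λ * ε ^ 2 := by nlinarith
    exact le_of_mul_le_mul_left this hΛpos
  have ht1 : t < 1 := by nlinarith
  let M : Matrix (Fin k) (Fin k) ℝ :=
    Matrix.of fun j l => alpha G P f j (Fin.castLE hkn.le l)
  have hBM : Matrix.of beta * M = 1 := by
    ext a l
    have h := hf.ortho (Fin.castLE hkn.le a) (Fin.castLE hkn.le l)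
    rw [hbeta a, dotV_sum_mul_left] at h
    simp_rw [hf.dotV_fhat] at h
    simpa [Matrix.mul_apply, Matrix.one_apply, M] using h
  have hsplit : ∀ x : Fin k → ℝ, ∑ l, (x ᵥ* M) l ^ 2 +
      (∑ l : Fin (Fintype.card V), if (l : ℕ) < k then 0 else
        (∑ j, x j * alpha G P f j l) ^ 2) = ∑ j, x j ^ 2 := by
    intro x
    have h1 : ∑ l, (x ᵥ* M) l ^ 2 = ∑ l : Fin (Fintype.card V), if (l : ℕ) < k then
        (∑ j, x j * alpha G P f j l) ^ 2 else 0 := by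
      rw [sum_ite_val_lt hkn.le]
      rfl
    rw [h1, ← Finset.sum_add_distrib, ← hf.sum_sq_alpha hd hPart x]
    refine Finset.sum_congr rfl fun l _ => ?_
    split_ifs <;> simp
  have hup : ∀ x : Fin k → ℝ, ∑ l, (x ᵥ* M) l ^ 2 ≤ ∑ j, x j ^ 2 := by
    intro x
    rw [← hsplit x]
    exact le_add_of_nonneg_right (by positivity)
  have hlow : ∀ x : Fin k → ℝ, (1 - t) * ∑ j, x j ^ 2 ≤ ∑ l, (x ᵥ* M) l ^ 2 := by
    intro x
    have h : (∑ l : Fin (Fintype.card V), if (l : ℕ) < k then 0 else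
        (∑ j, x j * alpha G P f j l) ^ 2) ≤ (∑ j, x j ^ 2) * t := by
      rw [htdef, Finset.sum_comm, Finset.mul_sum]
      refine Finset.sum_le_sum fun l _ => ?_
      split_ifs
      · simp
      · exact Finset.sum_mul_sq_le_sq_mul_sq _ _ _
    linarith [hsplit x]
  obtain ⟨h1, h2⟩ := sum_sq_column_bounds hBM ht1 hlow hup i
  simp only [Matrix.of_apply] at h1 h2
  simp_rw [← sq]
  refine ⟨by linarith, ?_⟩
  set s := ∑ l, beta l i ^ 2
  nlinarith

end SpectralClustering
end

section
/- If Ψ ≥ 1600·k^3/ε^2 for some ε ∈ (0,1), then writing B^T·B = I + E (so that E is symmetric with |E_{ij}| ≤ 4√(k/Ψ)), every eigenvalue λ of the symmetric matrix B·E·B^T satisfies |λ| ≤ ε/5; moreover every entry satisfies |(B·E·B^T)_{ij}| ≤ ε/5 for all i,j ∈ {1,…,k}. -/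
open Finset BigOperators Matrix

namespace SpectralClustering

variable {V : Type} [Fintype V] [DecidableEq V]

section MatrixBounds

variable {κ ι : Type*} [Fintype κ] [Fintype ι]

lemma dotProduct_self_nonneg (x : κ → ℝ) : 0 ≤ x ⬝ᵥ x :=
  Finset.sum_nonneg fun i _ => mul_self_nonneg (x i)

lemma dotProduct_sq_le (x y : κ → ℝ) : (x ⬝ᵥ y) ^ 2 ≤ (x ⬝ᵥ x) * (y ⬝ᵥ y) := by
  simpa [dotProduct, sq] using Finset.sum_mul_sq_le_sq_mul_sq Finset.univ x y

lemma vecMul_dotProduct_self_le (C : Matrix κ ι ℝ) (x : κ → ℝ) :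
    (x ᵥ* C) ⬝ᵥ (x ᵥ* C) ≤ (∑ i, ∑ j, C i j ^ 2) * (x ⬝ᵥ x) := by
  rw [Finset.sum_comm, Finset.sum_mul]
  refine Finset.sum_le_sum fun j _ => ?_
  have h := dotProduct_sq_le x (fun i => C i j)
  have h2 : (fun i => C i j) ⬝ᵥ (fun i => C i j) = ∑ i, C i j ^ 2 := by
    simp [dotProduct, sq]
  rw [h2] at h
  have h3 : (x ᵥ* C) j = x ⬝ᵥ fun i => C i j := rfl
  rw [h3]
  linarith

lemma dotProduct_gram_sq_le (C : Matrix κ ι ℝ) {δ : ℝ} (hδ : ∑ i, ∑ j, C i j ^ 2 ≤ δ)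
    (x y : κ → ℝ) :
    (x ⬝ᵥ ((C * Cᵀ) *ᵥ y)) ^ 2 ≤ δ ^ 2 * ((x ⬝ᵥ x) * (y ⬝ᵥ y)) := by
  have hx := vecMul_dotProduct_self_le C x
  have hy := vecMul_dotProduct_self_le C y
  have h0 : 0 ≤ ∑ i, ∑ j, C i j ^ 2 := by positivity
  have hxx : 0 ≤ x ⬝ᵥ x := dotProduct_self_nonneg x
  have hyy : 0 ≤ y ⬝ᵥ y := dotProduct_self_nonneg y
  have e : x ⬝ᵥ ((C * Cᵀ) *ᵥ y) = (x ᵥ* C) ⬝ᵥ (y ᵥ* C) := by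
    rw [← mulVec_mulVec, dotProduct_mulVec, mulVec_transpose]
  rw [e]
  calc _ ≤ _ := dotProduct_sq_le _ _
    _ ≤ (δ * (x ⬝ᵥ x)) * (δ * (y ⬝ᵥ y)) := by
        refine mul_le_mul (hx.trans (by gcongr)) (hy.trans (by gcongr))
          (dotProduct_self_nonneg _) (mul_nonneg (h0.trans hδ) hxx)
    _ = _ := by ring

lemma dotProduct_gram_self_le (C : Matrix κ ι ℝ) {δ : ℝ} (hδ : ∑ i, ∑ j, C i j ^ 2 ≤ δ)
    (x : κ → ℝ) : x ⬝ᵥ ((C * Cᵀ) *ᵥ x) ≤ δ * (x ⬝ᵥ x) := by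
  have e : x ⬝ᵥ ((C * Cᵀ) *ᵥ x) = (x ᵥ* C) ⬝ᵥ (x ᵥ* C) := by
    rw [← mulVec_mulVec, dotProduct_mulVec, mulVec_transpose]
  rw [e]
  refine (vecMul_dotProduct_self_le C x).trans ?_
  have hxx : 0 ≤ x ⬝ᵥ x := dotProduct_self_nonneg x
  gcongr

variable [DecidableEq κ]

lemma mul_transpose_sub_one_eq {a b : Matrix κ κ ℝ} {C : Matrix κ ι ℝ} (hba : b * a = 1)
    (ha : a * aᵀ + C * Cᵀ = 1) : b * bᵀ - 1 = b * (C * Cᵀ) * bᵀ := by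
  have hR : C * Cᵀ = 1 - a * aᵀ := by rw [← ha]; abel
  have h : b * (a * aᵀ) * bᵀ = 1 := by
    calc b * (a * aᵀ) * bᵀ = (b * a) * (b * a)ᵀ := by
          simp only [transpose_mul, Matrix.mul_assoc]
      _ = 1 := by rw [hba]; simp
  rw [hR, Matrix.mul_sub, Matrix.sub_mul, h, Matrix.mul_one]

lemma row_dotProduct_self_le {a b : Matrix κ κ ℝ} {C : Matrix κ ι ℝ} (hba : b * a = 1)
    (ha : a * aᵀ + C * Cᵀ = 1) {δ : ℝ} (hδ : ∑ i, ∑ j, C i j ^ 2 ≤ δ) (i : κ) :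
    (1 - δ) * (b i ⬝ᵥ b i) ≤ 1 := by
  have h := congrFun (congrFun (mul_transpose_sub_one_eq hba ha) i) i
  have h1 : (b * (C * Cᵀ) * bᵀ) i i = b i ⬝ᵥ ((C * Cᵀ) *ᵥ b i) := by
    rw [dotProduct_mulVec]; rfl
  have h2 : (b * bᵀ - 1) i i = b i ⬝ᵥ b i - 1 := by
    rw [Matrix.sub_apply, Matrix.one_apply_eq]; rfl
  rw [h1, h2] at h
  have := dotProduct_gram_self_le C hδ (b i)
  linarith

lemma abs_mul_transpose_sub_one_le {a b : Matrix κ κ ℝ} {C : Matrix κ ι ℝ} (hba : b * a = 1)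
    (ha : a * aᵀ + C * Cᵀ = 1) {δ : ℝ} (hδ : ∑ i, ∑ j, C i j ^ 2 ≤ δ) (hδ1 : δ < 1) (i j : κ) :
    |(b * bᵀ - 1) i j| ≤ δ / (1 - δ) := by
  have hδ0 : 0 ≤ δ := le_trans (by positivity) hδ
  have hpos : 0 < 1 - δ := by linarith
  have h1 : (b * bᵀ - 1) i j = b i ⬝ᵥ ((C * Cᵀ) *ᵥ b j) := by
    rw [mul_transpose_sub_one_eq hba ha, dotProduct_mulVec]; rfl
  have hi := row_dotProduct_self_le hba ha hδ i
  have hj := row_dotProduct_self_le hba ha hδ j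
  rw [h1]
  refine abs_le_of_sq_le_sq ?_ (by positivity)
  rw [← le_div_iff₀' hpos] at hi hj
  calc _ ≤ _ := dotProduct_gram_sq_le C hδ (b i) (b j)
    _ ≤ δ ^ 2 * ((1 / (1 - δ)) * (1 / (1 - δ))) := by
        have := dotProduct_self_nonneg (b j)
        gcongr
    _ = _ := by field_simp

lemma gram_mulVec_dotProduct_self_le {a b : Matrix κ κ ℝ} {C : Matrix κ ι ℝ} (hba : b * a = 1)
    (ha : a * aᵀ + C * Cᵀ = 1) {δ : ℝ} (hδ : ∑ i, ∑ j, C i j ^ 2 ≤ δ) (hδ1 : δ < 1)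
    (x : κ → ℝ) :
    (1 - δ) ^ 2 * (((bᵀ * b) *ᵥ x) ⬝ᵥ ((bᵀ * b) *ᵥ x)) ≤ x ⬝ᵥ x := by
  set z := (bᵀ * b) *ᵥ x with hz
  have hab : a * b = 1 := mul_eq_one_comm.mp hba
  have hinv : (a * aᵀ) * (bᵀ * b) = 1 := by
    calc (a * aᵀ) * (bᵀ * b) = a * (b * a)ᵀ * b := by
          simp only [transpose_mul, Matrix.mul_assoc]
      _ = 1 := by rw [hba]; simpa using hab
  have hx : x = z - (C * Cᵀ) *ᵥ z := by
    have : (a * aᵀ) *ᵥ z = x := by rw [hz, mulVec_mulVec, hinv, one_mulVec]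
    rw [← this, eq_sub_iff_add_eq, ← add_mulVec, ha, one_mulVec]
  have h1 : (1 - δ) * (z ⬝ᵥ z) ≤ z ⬝ᵥ x := by
    have h := dotProduct_gram_self_le C hδ z
    have e : z ⬝ᵥ x = z ⬝ᵥ z - z ⬝ᵥ ((C * Cᵀ) *ᵥ z) := by
      conv_lhs => rw [hx]
      rw [dotProduct_sub]
    linarith
  have h2 := dotProduct_sq_le z x
  have hzz : 0 ≤ z ⬝ᵥ z := dotProduct_self_nonneg z
  have hxx : 0 ≤ x ⬝ᵥ x := dotProduct_self_nonneg x
  rcases hzz.eq_or_lt with h0 | h0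
  · rw [← h0]; simpa using hxx
  · have h3 : ((1 - δ) * (z ⬝ᵥ z)) ^ 2 ≤ (z ⬝ᵥ z) * (x ⬝ᵥ x) := by
      refine le_trans ?_ h2
      have : 0 ≤ (1 - δ) * (z ⬝ᵥ z) := mul_nonneg (by linarith) hzz
      gcongr
    refine le_of_mul_le_mul_left ?_ h0
    linarith

lemma abs_dotProduct_conj_mulVec_le {a b : Matrix κ κ ℝ} {C : Matrix κ ι ℝ} (hba : b * a = 1)
    (ha : a * aᵀ + C * Cᵀ = 1) {δ : ℝ} (hδ : ∑ i, ∑ j, C i j ^ 2 ≤ δ) (hδ1 : δ < 1)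
    (x y : κ → ℝ) :
    (x ⬝ᵥ ((bᵀ * (b * bᵀ - 1) * b) *ᵥ y)) ^ 2 ≤
      (δ / (1 - δ) ^ 2) ^ 2 * ((x ⬝ᵥ x) * (y ⬝ᵥ y)) := by
  have hpos : 0 < (1 - δ) ^ 2 := pow_pos (by linarith) 2
  have e : x ⬝ᵥ ((bᵀ * (b * bᵀ - 1) * b) *ᵥ y) =
      ((bᵀ * b) *ᵥ x) ⬝ᵥ ((C * Cᵀ) *ᵥ ((bᵀ * b) *ᵥ y)) := by
    have h1 : bᵀ * (b * bᵀ - 1) * b = (bᵀ * b)ᵀ * ((C * Cᵀ) * (bᵀ * b)) := by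
      rw [mul_transpose_sub_one_eq hba ha]
      simp only [transpose_mul, transpose_transpose, Matrix.mul_assoc]
    rw [h1, ← mulVec_mulVec, ← mulVec_mulVec, dotProduct_mulVec, vecMul_transpose]
  have hx := gram_mulVec_dotProduct_self_le hba ha hδ hδ1 x
  have hy := gram_mulVec_dotProduct_self_le hba ha hδ hδ1 y
  rw [← le_div_iff₀' hpos] at hx hy
  rw [e]
  have hxx : 0 ≤ x ⬝ᵥ x := dotProduct_self_nonneg x
  calc _ ≤ _ := dotProduct_gram_sq_le C hδ _ _
    _ ≤ δ ^ 2 * (((x ⬝ᵥ x) / (1 - δ) ^ 2) * ((y ⬝ᵥ y) / (1 - δ) ^ 2)) := by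
        have := dotProduct_self_nonneg ((bᵀ * b) *ᵥ y)
        gcongr
    _ = _ := by field_simp

lemma abs_conj_apply_le {a b : Matrix κ κ ℝ} {C : Matrix κ ι ℝ} (hba : b * a = 1)
    (ha : a * aᵀ + C * Cᵀ = 1) {δ : ℝ} (hδ : ∑ i, ∑ j, C i j ^ 2 ≤ δ) (hδ1 : δ < 1) (i j : κ) :
    |(bᵀ * (b * bᵀ - 1) * b) i j| ≤ δ / (1 - δ) ^ 2 := by
  have hδ0 : 0 ≤ δ := le_trans (by positivity) hδ
  have h := abs_dotProduct_conj_mulVec_le hba ha hδ hδ1 (Pi.single i 1) (Pi.single j 1)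
  refine abs_le_of_sq_le_sq ?_ (by positivity)
  simpa using h

lemma abs_eigenvalue_conj_le {a b : Matrix κ κ ℝ} {C : Matrix κ ι ℝ} (hba : b * a = 1)
    (ha : a * aᵀ + C * Cᵀ = 1) {δ : ℝ} (hδ : ∑ i, ∑ j, C i j ^ 2 ≤ δ) (hδ1 : δ < 1) {μ : ℝ}
    (hμ : Module.End.HasEigenvalue (Matrix.toLin' (bᵀ * (b * bᵀ - 1) * b)) μ) :
    |μ| ≤ δ / (1 - δ) ^ 2 := by
  have hδ0 : 0 ≤ δ := le_trans (by positivity) hδ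
  obtain ⟨v, hv⟩ := hμ.exists_hasEigenvector
  have hv1 : (bᵀ * (b * bᵀ - 1) * b) *ᵥ v = μ • v := hv.apply_eq_smul
  have h := abs_dotProduct_conj_mulVec_le hba ha hδ hδ1 v v
  have hvv : 0 < v ⬝ᵥ v :=
    lt_of_le_of_ne (dotProduct_self_nonneg v) fun h => hv.2 (dotProduct_self_eq_zero.mp h.symm)
  rw [hv1, dotProduct_smul, smul_eq_mul, mul_pow, sq (v ⬝ᵥ v)] at h
  exact abs_le_of_sq_le_sq (le_of_mul_le_mul_right h (by positivity)) (by positivity)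

end MatrixBounds

lemma sum_castLE {k n : ℕ} (hk : k ≤ n) (g : Fin n → ℝ) :
    ∑ l : Fin k, g (Fin.castLE hk l) = ∑ l : Fin n, if (l : ℕ) < k then g l else 0 := by
  obtain ⟨m, rfl⟩ := Nat.exists_eq_add_of_le hk
  rw [Fin.sum_univ_add]
  simp
  rfl

section Spectral

variable {G : SimpleGraph V} [DecidableRel G.Adj]

lemma dotProduct_normLap_mulVec (hd : ∀ v : V, 0 < G.degree v) (x : V → ℝ) :
    x ⬝ᵥ (normLap G *ᵥ x) =
      (∑ u, ∑ v, if G.Adj u v then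
        (x u / √(G.degree u : ℝ) - x v / √(G.degree v : ℝ)) ^ 2 else 0) / 2 := by
  set D : Matrix V V ℝ := Matrix.diagonal fun v => (√(G.degree v : ℝ))⁻¹ with hD
  have hDD : D * G.degMatrix ℝ * D = 1 := by
    rw [hD, SimpleGraph.degMatrix, diagonal_mul_diagonal, diagonal_mul_diagonal,
      ← diagonal_one]
    congr 1
    ext v
    have h0 : (0 : ℝ) < G.degree v := by exact_mod_cast hd v
    have h1 : 0 < √(G.degree v : ℝ) := Real.sqrt_pos.mpr h0
    field_simp
    exact (Real.sq_sqrt h0.le).symm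
  have hL : normLap G = D * G.lapMatrix ℝ * D := by
    rw [SimpleGraph.lapMatrix, Matrix.mul_sub, Matrix.sub_mul, hDD]; rfl
  have hDx : D *ᵥ x = fun v => x v / √(G.degree v : ℝ) := by
    ext v; simp [hD, mulVec_diagonal, div_eq_inv_mul]
  have hxD : x ᵥ* D = fun v => x v / √(G.degree v : ℝ) := by
    ext v; simp [hD, vecMul_diagonal, div_eq_mul_inv]
  have h := G.lapMatrix_toLinearMap₂' (R := ℝ) (fun v => x v / √(G.degree v : ℝ))
  rw [Matrix.toLinearMap₂'_apply'] at h
  rw [← h, hL, ← mulVec_mulVec, ← mulVec_mulVec, dotProduct_mulVec, hxD, hDx]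

lemma eigenvalue_nonneg (hd : ∀ v : V, 0 < G.degree v)
    {f : Fin (Fintype.card V) → V → ℝ} {lam : Fin (Fintype.card V) → ℝ}
    (hf : EigenData G f lam) (i : Fin (Fintype.card V)) : 0 ≤ lam i := by
  have h := dotProduct_normLap_mulVec hd (f i)
  have h1 : f i ⬝ᵥ f i = 1 := (hf.ortho i i).trans (if_pos rfl)
  rw [hf.eig, dotProduct_smul, h1, smul_eq_mul, mul_one] at h
  rw [h]
  refine div_nonneg (Finset.sum_nonneg fun u _ => Finset.sum_nonneg fun v _ => ?_) two_pos.le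
  split_ifs <;> positivity

lemma conductance_nonneg (S : Finset V) : 0 ≤ conductance G S := by
  unfold conductance; positivity

lemma sum_adj_indicator_sq_sub (S : Finset V) :
    (∑ u, ∑ v, if G.Adj u v then
      ((if u ∈ S then (1 : ℝ) else 0) - (if v ∈ S then 1 else 0)) ^ 2 else 0) =
      2 * (cut G S Sᶜ : ℝ) := by
  have hcut : (cut G S Sᶜ : ℝ) =
      ∑ u, ∑ v, if G.Adj u v ∧ u ∈ S ∧ v ∉ S then (1 : ℝ) else 0 := by
    rw [cut, Nat.cast_sum, ← Finset.sum_filter_add_sum_filter_not Finset.univ (· ∈ S)]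
    have h2 : ∑ u with u ∉ S, ∑ v, (if G.Adj u v ∧ u ∈ S ∧ v ∉ S then (1 : ℝ) else 0) = 0 := by
      refine Finset.sum_eq_zero fun u hu => Finset.sum_eq_zero fun v _ => ?_
      simp at hu
      simp [hu]
    rw [h2, add_zero, Finset.filter_mem_eq_inter, Finset.univ_inter]
    refine Finset.sum_congr rfl fun u hu => ?_
    rw [Finset.sum_boole]
    congr 2
    ext v
    simp [hu, and_comm]
  have hcut' : (cut G S Sᶜ : ℝ) =
      ∑ u, ∑ v, if G.Adj u v ∧ v ∈ S ∧ u ∉ S then (1 : ℝ) else 0 := by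
    rw [hcut, Finset.sum_comm]
    simp only [G.adj_comm]
  rw [two_mul]
  nth_rewrite 1 [hcut]
  rw [hcut', ← Finset.sum_add_distrib]
  refine Finset.sum_congr rfl fun u _ => ?_
  rw [← Finset.sum_add_distrib]
  refine Finset.sum_congr rfl fun v _ => ?_
  by_cases h : G.Adj u v <;> by_cases hu : u ∈ S <;> by_cases hv : v ∈ S <;> simp [h, hu, hv]

lemma gbar_dotProduct_normLap_mulVec (hd : ∀ v : V, 0 < G.degree v) {k : ℕ}
    (P : Fin k → Finset V) (i : Fin k) :
    gbar G P i ⬝ᵥ (normLap G *ᵥ gbar G P i) = conductance G (P i) := by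
  rw [dotProduct_normLap_mulVec hd]
  have h : ∀ v, gbar G P i v / √(G.degree v : ℝ) =
      (if v ∈ P i then (1 : ℝ) else 0) / √(vol G (P i) : ℝ) := by
    intro v
    have h1 : √(G.degree v : ℝ) ≠ 0 := (Real.sqrt_pos.mpr (by exact_mod_cast hd v)).ne'
    unfold gbar
    split_ifs
    · field_simp
    · simp
  simp only [h, ← sub_div, div_pow, Real.sq_sqrt (Nat.cast_nonneg (vol G (P i)))]
  have h2 : ∀ u v, (if G.Adj u v then
      ((if u ∈ P i then (1 : ℝ) else 0) - (if v ∈ P i then 1 else 0)) ^ 2 / (vol G (P i) : ℝ)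
      else 0) = (if G.Adj u v then
      ((if u ∈ P i then (1 : ℝ) else 0) - (if v ∈ P i then 1 else 0)) ^ 2 else 0) /
        (vol G (P i) : ℝ) := by
    intro u v; split_ifs <;> simp
  simp only [h2, ← Finset.sum_div]
  rw [sum_adj_indicator_sq_sub, conductance]
  ring

lemma gbar_dotProduct_gbar (hd : ∀ v : V, 0 < G.degree v) {k : ℕ} {P : Fin k → Finset V}
    (hP : IsKWayPartition P) (i j : Fin k) :
    gbar G P i ⬝ᵥ gbar G P j = if i = j then 1 else 0 := by
  split_ifs with hij
  · subst hij
    have hv : (0 : ℝ) < vol G (P i) := 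
      Nat.cast_pos.mpr (Finset.sum_pos (fun v _ => hd v) (hP.1 i))
    have h : ∀ v, gbar G P i v * gbar G P i v =
        (if v ∈ P i then (G.degree v : ℝ) else 0) / vol G (P i) := by
      intro v
      unfold gbar
      rw [div_mul_div_comm, Real.mul_self_sqrt hv.le]
      split_ifs
      · rw [Real.mul_self_sqrt (Nat.cast_nonneg _)]
      · simp
    rw [dotProduct, Finset.sum_congr rfl fun v _ => h v, ← Finset.sum_div, Finset.sum_ite_mem,
      Finset.univ_inter, ← Nat.cast_sum]
    exact div_self hv.ne'
  · refine Finset.sum_eq_zero fun v _ => ?_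
    by_cases hi : v ∈ P i
    · have hj : v ∉ P j := Finset.disjoint_left.mp (hP.2.1 i j hij) hi
      simp [gbar, hj]
    · simp [gbar, hi]

lemma eigenvectors_transpose_mul_self
    {f : Fin (Fintype.card V) → V → ℝ} {lam : Fin (Fintype.card V) → ℝ}
    (hf : EigenData G f lam) : (Matrix.of f)ᵀ * Matrix.of f = 1 := by
  refine (mul_eq_one_comm_of_card_eq _ _ _ (Fintype.card_fin _)).mp ?_
  ext i j
  rw [Matrix.one_apply, ← hf.ortho i j]
  rfl

lemma sum_alpha_mul_alpha (hd : ∀ v : V, 0 < G.degree v)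
    {f : Fin (Fintype.card V) → V → ℝ} {lam : Fin (Fintype.card V) → ℝ}
    (hf : EigenData G f lam) {k : ℕ} {P : Fin k → Finset V} (hP : IsKWayPartition P)
    (i j : Fin k) :
    ∑ l, alpha G P f i l * alpha G P f j l = if i = j then 1 else 0 := by
  have h : ∑ l, alpha G P f i l * alpha G P f j l =
      (gbar G P i ᵥ* (Matrix.of f)ᵀ) ⬝ᵥ (gbar G P j ᵥ* (Matrix.of f)ᵀ) := rfl
  rw [h, ← gbar_dotProduct_gbar hd hP, ← mulVec_transpose, ← mulVec_transpose,
    transpose_transpose, dotProduct_mulVec, ← mulVec_transpose, mulVec_mulVec,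
    eigenvectors_transpose_mul_self hf, one_mulVec]

lemma sum_eigenvalue_mul_alpha_sq (hd : ∀ v : V, 0 < G.degree v)
    {f : Fin (Fintype.card V) → V → ℝ} {lam : Fin (Fintype.card V) → ℝ}
    (hf : EigenData G f lam) {k : ℕ} (P : Fin k → Finset V) (i : Fin k) :
    ∑ l, lam l * alpha G P f i l ^ 2 = conductance G (P i) := by
  have hL : normLap G * (Matrix.of f)ᵀ = (Matrix.of f)ᵀ * Matrix.diagonal lam := by
    ext v l
    have h := congrFun (hf.eig l) v
    rw [mul_diagonal]
    exact h.trans (mul_comm _ _)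
  have h1 : normLap G = (Matrix.of f)ᵀ * Matrix.diagonal lam * Matrix.of f := by
    rw [← hL, Matrix.mul_assoc, eigenvectors_transpose_mul_self hf, Matrix.mul_one]
  have ha : Matrix.of f *ᵥ gbar G P i = alpha G P f i := by
    ext l; exact dotProduct_comm _ _
  rw [← gbar_dotProduct_normLap_mulVec hd P i, h1, ← mulVec_mulVec, ← mulVec_mulVec,
    dotProduct_mulVec, vecMul_transpose, ha]
  refine Finset.sum_congr rfl fun l _ => ?_
  rw [mulVec_diagonal]
  ring

/-- The coefficients of the vectors `ḡ_i` outside the span of the first `k` eigenvectors. -/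
noncomputable def alphaTail (G : SimpleGraph V) [DecidableRel G.Adj] {k : ℕ}
    (P : Fin k → Finset V) (f : Fin (Fintype.card V) → V → ℝ) :
    Matrix (Fin k) (Fin (Fintype.card V)) ℝ :=
  Matrix.of fun i l => if (l : ℕ) < k then 0 else alpha G P f i l

/-- The coefficients of the vectors `ḡ_i` along the first `k` eigenvectors. -/
noncomputable def alphaHead (G : SimpleGraph V) [DecidableRel G.Adj] {k : ℕ}
    (hk : k ≤ Fintype.card V) (P : Fin k → Finset V) (f : Fin (Fintype.card V) → V → ℝ) :
    Matrix (Fin k) (Fin k) ℝ :=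
  Matrix.of fun i l => alpha G P f i (Fin.castLE hk l)

lemma alphaHead_mul_transpose_add (hd : ∀ v : V, 0 < G.degree v)
    {f : Fin (Fintype.card V) → V → ℝ} {lam : Fin (Fintype.card V) → ℝ}
    (hf : EigenData G f lam) {k : ℕ} (hk : k ≤ Fintype.card V) {P : Fin k → Finset V}
    (hP : IsKWayPartition P) :
    alphaHead G hk P f * (alphaHead G hk P f)ᵀ + alphaTail G P f * (alphaTail G P f)ᵀ = 1 := by
  ext i j
  rw [Matrix.one_apply, ← sum_alpha_mul_alpha hd hf hP i j]
  simp only [Matrix.add_apply, Matrix.mul_apply, transpose_apply, alphaHead, alphaTail, of_apply]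
  rw [sum_castLE hk fun l => alpha G P f i l * alpha G P f j l, ← Finset.sum_add_distrib]
  refine Finset.sum_congr rfl fun l _ => ?_
  split_ifs <;> simp

lemma beta_mul_alphaHead
    {f : Fin (Fintype.card V) → V → ℝ} {lam : Fin (Fintype.card V) → ℝ}
    (hf : EigenData G f lam) {k : ℕ} (hk : k ≤ Fintype.card V) {P : Fin k → Finset V}
    {beta : Fin k → Fin k → ℝ}
    (hbeta : ∀ i : Fin k,
      f (Fin.castLE hk i) = fun v => ∑ j : Fin k, beta i j * fhat G P f j v) :
    Matrix.of beta * alphaHead G hk P f = 1 := by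
  have hfhat : ∀ (j : Fin k) (l : Fin k),
      fhat G P f j ⬝ᵥ f (Fin.castLE hk l) = alpha G P f j (Fin.castLE hk l) := by
    intro j l
    have h1 : fhat G P f j = ∑ m : Fin (Fintype.card V),
        (if (m : ℕ) < k then alpha G P f j m else 0) • f m := by
      ext v
      simp [fhat, Finset.sum_apply, ite_apply, ite_smul]
    have h2 : ∀ m, f m ⬝ᵥ f (Fin.castLE hk l) = if m = Fin.castLE hk l then 1 else 0 :=
      fun m => hf.ortho m _
    rw [h1, sum_dotProduct]
    simp only [smul_dotProduct, h2, smul_eq_mul, mul_ite, mul_one,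
      mul_zero, Finset.sum_ite_eq', Finset.mem_univ, if_true, Fin.val_castLE, l.isLt]
  ext i l
  have h2 : f (Fin.castLE hk i) = ∑ j, beta i j • fhat G P f j := by
    rw [hbeta i]
    ext v
    simp [Finset.sum_apply]
  have h3 : f (Fin.castLE hk i) ⬝ᵥ f (Fin.castLE hk l) = if i = l then 1 else 0 := by
    refine (hf.ortho (Fin.castLE hk i) (Fin.castLE hk l)).trans ?_
    simp only [(Fin.castLE_injective hk).eq_iff]
  rw [Matrix.one_apply, ← h3, h2, sum_dotProduct]
  simp only [smul_dotProduct, hfhat]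
  rfl

lemma sum_alphaTail_sq_le (hd : ∀ v : V, 0 < G.degree v)
    {f : Fin (Fintype.card V) → V → ℝ} {lam : Fin (Fintype.card V) → ℝ}
    (hf : EigenData G f lam) {k : ℕ} (hkn : k < Fintype.card V) (P : Fin k → Finset V)
    (hlam : 0 < lam ⟨k, hkn⟩) :
    ∑ i, ∑ l, alphaTail G P f i l ^ 2 ≤ (k : ℝ) / Psi G lam P hkn := by
  have h : ∀ i, ∑ l, alphaTail G P f i l ^ 2 ≤ conductance G (P i) / lam ⟨k, hkn⟩ := by
    intro i
    rw [le_div_iff₀' hlam, ← sum_eigenvalue_mul_alpha_sq hd hf P i, Finset.mul_sum]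
    refine Finset.sum_le_sum fun l _ => ?_
    simp only [alphaTail, of_apply]
    split_ifs with hl
    · have := eigenvalue_nonneg hd hf l
      rw [zero_pow two_ne_zero, mul_zero]
      positivity
    · have : lam ⟨k, hkn⟩ ≤ lam l := hf.mono (Fin.mk_le_of_le_val (not_lt.mp hl))
      gcongr
  refine (Finset.sum_le_sum fun i _ => h i).trans (le_of_eq ?_)
  rw [← Finset.sum_div, Psi, avgCond]
  rcases Nat.eq_zero_or_pos k with rfl | hk
  · simp
  · have : (k : ℝ) ≠ 0 := by positivity
    field_simp

end Spectral

theorem BEBT_eigenvalues_and_entries_small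
    {V : Type} [Fintype V] [DecidableEq V] (G : SimpleGraph V) [DecidableRel G.Adj]
    (hd : ∀ v : V, 0 < G.degree v)
    {k : ℕ} (hkn : k < Fintype.card V)
    (f : Fin (Fintype.card V) → V → ℝ) (lam : Fin (Fintype.card V) → ℝ)
    (hf : EigenData G f lam)
    (P : Fin k → Finset V) (hP : AchievesRhoAvr G P)
    (beta : Fin k → Fin k → ℝ)
    (hbeta : ∀ i : Fin k,
      f (Fin.castLE hkn.le i) = fun v => ∑ j : Fin k, beta i j * fhat G P f j v)
    (ε : ℝ) (hε0 : 0 < ε) (hε1 : ε < 1)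
    (hPsi : Psi G lam P hkn ≥ 1600 * (k : ℝ) ^ 3 / ε ^ 2) :
    let B : Matrix (Fin k) (Fin k) ℝ := Matrix.of fun j i => beta i j
    let E : Matrix (Fin k) (Fin k) ℝ := Bᵀ * B - 1
    let M : Matrix (Fin k) (Fin k) ℝ := B * E * Bᵀ
    E.IsSymm ∧
      (∀ i j : Fin k, |E i j| ≤ 4 * Real.sqrt ((k : ℝ) / Psi G lam P hkn)) ∧
      (∀ μ : ℝ, Module.End.HasEigenvalue (Matrix.toLin' M) μ → |μ| ≤ ε / 5) ∧
      ∀ i j : Fin k, |M i j| ≤ ε / 5 := by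
  intro B E M
  rcases Nat.eq_zero_or_pos k with hk0 | hk
  · subst hk0
    exact ⟨Subsingleton.elim _ _, fun i => i.elim0,
      fun μ hμ => (hμ.exists_hasEigenvector.choose_spec.2 (Subsingleton.elim _ _)).elim,
      fun i => i.elim0⟩
  have hk1 : (1 : ℝ) ≤ k := by exact_mod_cast hk
  have hΨ : 0 < Psi G lam P hkn := lt_of_lt_of_le (by positivity) hPsi
  have havg : 0 ≤ avgCond G P :=
    div_nonneg (Finset.sum_nonneg fun i _ => conductance_nonneg _) (Nat.cast_nonneg _)
  have hlam : 0 < lam ⟨k, hkn⟩ := by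
    refine lt_of_not_ge fun h => hΨ.not_ge ?_
    exact div_nonpos_of_nonpos_of_nonneg h havg
  have hba := beta_mul_alphaHead hf hkn.le hbeta
  have ha := alphaHead_mul_transpose_add hd hf hkn.le hP.1
  have hδ := sum_alphaTail_sq_le hd hf hkn P hlam
  set δ : ℝ := (k : ℝ) / Psi G lam P hkn with hδ_def
  have hδ0 : 0 ≤ δ := by positivity
  have hδε : 1600 * δ ≤ ε ^ 2 := by
    have h1 : 1600 * (k : ℝ) ^ 3 ≤ Psi G lam P hkn * ε ^ 2 := by
      rwa [ge_iff_le, div_le_iff₀ (by positivity)] at hPsi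
    have h2 : (k : ℝ) ≤ (k : ℝ) ^ 3 := le_self_pow₀ hk1 (by norm_num)
    rw [hδ_def, ← mul_div_assoc, div_le_iff₀ hΨ]
    linarith
  have hε2 : ε ^ 2 ≤ ε := by nlinarith
  have hδ1 : δ < 1 := by linarith
  have hM : δ / (1 - δ) ^ 2 ≤ ε / 5 := by
    rw [div_le_iff₀ (by nlinarith)]
    have : (1 / 4 : ℝ) ≤ (1 - δ) ^ 2 := by nlinarith
    nlinarith
  have hE : δ / (1 - δ) ≤ 4 * √δ := by
    have h1 : √δ * √δ = δ := Real.mul_self_sqrt hδ0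
    have h2 : √δ ≤ 1 := Real.sqrt_le_one.mpr hδ1.le
    have h3 := Real.sqrt_nonneg δ
    rw [div_le_iff₀ (by linarith)]
    nlinarith
  refine ⟨?_, fun i j => ?_, fun μ hμ => ?_, fun i j => ?_⟩
  · simp [Matrix.IsSymm, E]
  · exact (abs_mul_transpose_sub_one_le hba ha hδ hδ1 i j).trans hE
  · exact (abs_eigenvalue_conj_le hba ha hδ hδ1 hμ).trans hM
  · exact (abs_conj_apply_le hba ha hδ hδ1 i j).trans hM

end SpectralClustering
end
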